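/- arXiv:1909.01295 — 3 statements merged into one kernel-verified Lean document; each statement's English description precedes it below -/
import Mathlib

section
/- Let l ≥ 1 be a natural number and let B, ε, m, f, f' be real numbers with B > 0, ε ≥ 0, 0 < m, m ≤ f, m ≤ f'. If |B·f'^l − B·f^l| ≤ l·ε, then |f' − f| ≤ ε / (B · m^(l−1)). -/
/-- Rigorous version of Lemma F.3: bound on the error in the extracted fidelity
decay parameter. -/
theorem fidelity_param_error_bound (l : ℕ) (hl : 1 ≤ l) (B ε m f f' : ℝ)
    (hB : 0 < B) (hε : 0 ≤ ε) (hm : 0 < m) (hmf : m ≤ f) (hmf' : m ≤ f')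
    (h : |B * f' ^ l - B * f ^ l| ≤ (l : ℝ) * ε) :
    |f' - f| ≤ ε / (B * m ^ (l - 1)) := by
  have hl0 : (0 : ℝ) < l := by exact_mod_cast hl
  have hS : (l : ℝ) * m ^ (l - 1) ≤ ∑ i ∈ Finset.range l, f' ^ i * f ^ (l - 1 - i) := by
    have h1 : ∀ i ∈ Finset.range l, m ^ (l - 1) ≤ f' ^ i * f ^ (l - 1 - i) := by
      intro i hi
      have hi' : i + (l - 1 - i) = l - 1 := by
        have := Finset.mem_range.mp hi
        omega
      calc m ^ (l - 1) = m ^ i * m ^ (l - 1 - i) := by rw [← pow_add, hi']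
        _ ≤ f' ^ i * f ^ (l - 1 - i) := by
          have : 0 ≤ f' := hm.le.trans hmf'
          gcongr
    have h2 := Finset.card_nsmul_le_sum _ _ _ h1
    simpa using h2
  have hpos : 0 ≤ ∑ i ∈ Finset.range l, f' ^ i * f ^ (l - 1 - i) :=
    le_trans (by positivity) hS
  rw [← mul_sub, ← geom_sum₂_mul, abs_mul, abs_mul, abs_of_pos hB, abs_of_nonneg hpos] at h
  rw [le_div_iff₀ (by positivity)]
  refine le_of_mul_le_mul_left ?_ hl0
  calc (l : ℝ) * (|f' - f| * (B * m ^ (l - 1)))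
      = B * ((l * m ^ (l - 1)) * |f' - f|) := by ring
    _ ≤ B * ((∑ i ∈ Finset.range l, f' ^ i * f ^ (l - 1 - i)) * |f' - f|) := by gcongr
    _ ≤ l * ε := h
end

section
/- Let d ≥ 1 be a natural number, let ψ ∈ ℂ^d be a unit vector, let P_ψ be the d×d matrix with entries (P_ψ)_{ij} = ψ_i · conj(ψ_j), let p_s, p_e be real numbers, and let l be a natural number. Then tr(P_ψ · D_{p_s}(D_{p_e}^[l](P_ψ))) = 1/d + ((d−1)/d) · p_s · p_e^l. -/
/-- The depolarizing channel with parameter `p` on `d×d` complex matrices: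
`D_p(X) = p·X + ((1−p)/d)·tr(X)·I`. -/
noncomputable def depol (d : ℕ) (p : ℝ) (X : Matrix (Fin d) (Fin d) ℂ) :
    Matrix (Fin d) (Fin d) ℂ :=
  (p : ℂ) • X + (((1 - p) / d : ℝ) : ℂ) • (Matrix.trace X • (1 : Matrix (Fin d) (Fin d) ℂ))

/-- Eq. (A13): the randomized-benchmarking decay curve
`P_l = 1/d + ((d−1)/d)·p_s·p_e^l`. -/
theorem survival_probability_decay (d : ℕ) (hd : 1 ≤ d) (ψ : Fin d → ℂ)
    (hψ : ∑ i, Complex.normSq (ψ i) = 1)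
    (Pψ : Matrix (Fin d) (Fin d) ℂ)
    (hPψ : ∀ i j, Pψ i j = ψ i * (starRingEnd ℂ) (ψ j))
    (ps pe : ℝ) (l : ℕ) :
    Matrix.trace (Pψ * depol d ps ((depol d pe)^[l] Pψ)) =
      1 / (d : ℂ) + (((d : ℂ) - 1) / (d : ℂ)) * (ps : ℂ) * (pe : ℂ) ^ l := by
  have hd0 : (d : ℂ) ≠ 0 := by
    exact_mod_cast (by omega : d ≠ 0)
  have hsum : ∑ i, ψ i * (starRingEnd ℂ) (ψ i) = 1 := by
    simp only [Complex.mul_conj]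
    exact_mod_cast hψ
  have htr : Matrix.trace Pψ = 1 := by
    simp only [Matrix.trace, Matrix.diag_apply, hPψ]
    exact hsum
  have hsq : Pψ * Pψ = Pψ := by
    ext i j
    simp only [Matrix.mul_apply, hPψ]
    calc ∑ k, ψ i * (starRingEnd ℂ) (ψ k) * (ψ k * (starRingEnd ℂ) (ψ j))
        = ∑ k, (ψ i * (starRingEnd ℂ) (ψ j)) * (ψ k * (starRingEnd ℂ) (ψ k)) :=
          Finset.sum_congr rfl (fun k _ => by ring)
      _ = ψ i * (starRingEnd ℂ) (ψ j) := by rw [← Finset.mul_sum, hsum, mul_one]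
  have htrD : ∀ (p : ℝ) (X : Matrix (Fin d) (Fin d) ℂ),
      Matrix.trace (depol d p X) = Matrix.trace X := by
    intro p X
    simp only [depol, Matrix.trace_add, Matrix.trace_smul, Matrix.trace_one, Fintype.card_fin,
      smul_eq_mul]
    push_cast
    field_simp
    ring
  have hovD : ∀ (p : ℝ) (X : Matrix (Fin d) (Fin d) ℂ), Matrix.trace X = 1 →
      Matrix.trace (Pψ * depol d p X) = p * Matrix.trace (Pψ * X) + (1 - p) / d := by
    intro p X hX
    simp only [depol, Matrix.mul_add, Matrix.mul_smul, Matrix.trace_add, Matrix.trace_smul,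
      Matrix.mul_one, smul_eq_mul, hX, htr]
    push_cast
    ring
  have hit : ∀ n : ℕ, Matrix.trace ((depol d pe)^[n] Pψ) = 1 ∧
      Matrix.trace (Pψ * (depol d pe)^[n] Pψ) =
        1 / (d : ℂ) + (((d : ℂ) - 1) / (d : ℂ)) * (pe : ℂ) ^ n := by
    intro n
    induction n with
    | zero =>
      refine ⟨htr, ?_⟩
      simp only [Function.iterate_zero, id_eq, hsq, htr, pow_zero]
      field_simp
      ring
    | succ n ih =>
      rw [Function.iterate_succ_apply']
      refine ⟨by rw [htrD, ih.1], ?_⟩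
      rw [hovD _ _ ih.1, ih.2]
      field_simp
      ring
  rw [hovD _ _ (hit l).1, (hit l).2]
  field_simp
  ring
end

section
/- Let d ≥ 1 and l ≥ 1 be natural numbers, let ψ ∈ ℂ^d be a unit vector, let P_ψ be the d×d matrix with entries (P_ψ)_{ij} = ψ_i · conj(ψ_j), and let p_e, p, p_2 be real numbers. Then tr(P_ψ · D_{p_e}(D_p(D_{p_2}^[l−1](P_ψ)))) = 1/d + ((d−1)/d) · p_e · p · p_2^(l−1). -/
/-- Appendix B: survival probability with noisy time-inversion,
`P_l = 1/d + ((d−1)/d)·p_e·p·p_2^(l−1)`. -/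
theorem survival_probability_noisy_inversion (d l : ℕ) (hd : 1 ≤ d) (hl : 1 ≤ l)
    (ψ : Fin d → ℂ) (hψ : ∑ i, Complex.normSq (ψ i) = 1)
    (Pψ : Matrix (Fin d) (Fin d) ℂ)
    (hPψ : ∀ i j, Pψ i j = ψ i * (starRingEnd ℂ) (ψ j))
    (pe p p2 : ℝ) :
    Matrix.trace (Pψ * depol d pe (depol d p ((depol d p2)^[l - 1] Pψ))) =
      1 / (d : ℂ) + (((d : ℂ) - 1) / (d : ℂ)) * (pe : ℂ) * (p : ℂ) * (p2 : ℂ) ^ (l - 1) := by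
  have hd0 : (d : ℂ) ≠ 0 := by
    have : d ≠ 0 := by omega
    exact_mod_cast this
  have hsum : ∑ i, ψ i * (starRingEnd ℂ) (ψ i) = 1 := by
    simp_rw [Complex.mul_conj]
    exact_mod_cast hψ
  have htr : Matrix.trace Pψ = 1 := by
    simp only [Matrix.trace, Matrix.diag, hPψ]
    exact hsum
  have hsq : Pψ * Pψ = Pψ := by
    ext i j
    rw [Matrix.mul_apply]
    simp only [hPψ]
    calc ∑ k, ψ i * (starRingEnd ℂ) (ψ k) * (ψ k * (starRingEnd ℂ) (ψ j))
        = ∑ k, (ψ i * (starRingEnd ℂ) (ψ j)) * (ψ k * (starRingEnd ℂ) (ψ k)) :=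
          Finset.sum_congr rfl (fun k _ => by ring)
      _ = ψ i * (starRingEnd ℂ) (ψ j) := by rw [← Finset.mul_sum, hsum, mul_one]
  have h1 : ∀ (q : ℝ) (X : Matrix (Fin d) (Fin d) ℂ), Matrix.trace X = 1 →
      Matrix.trace (depol d q X) = 1 := by
    intro q X hX
    simp only [depol, Matrix.trace_add, Matrix.trace_smul, Matrix.trace_one, hX, smul_eq_mul,
      Fintype.card_fin]
    push_cast
    field_simp
    ring
  have h2 : ∀ (q : ℝ) (X : Matrix (Fin d) (Fin d) ℂ), Matrix.trace X = 1 →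
      Matrix.trace (Pψ * depol d q X) = q * Matrix.trace (Pψ * X) + (1 - q) / d := by
    intro q X hX
    simp only [depol, Matrix.mul_add, Matrix.mul_smul, Matrix.trace_add, Matrix.trace_smul,
      Matrix.mul_one, hX, htr, smul_eq_mul]
    push_cast
    ring
  have h3 : ∀ n : ℕ, Matrix.trace ((depol d p2)^[n] Pψ) = 1 ∧
      Matrix.trace (Pψ * (depol d p2)^[n] Pψ) = 1 / d + ((d : ℂ) - 1) / d * (p2 : ℂ) ^ n := by
    intro n
    induction n with
    | zero =>
      refine ⟨htr, ?_⟩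
      simp only [Function.iterate_zero, id, hsq, htr]
      field_simp
      ring
    | succ n ih =>
      rw [Function.iterate_succ_apply']
      refine ⟨h1 _ _ ih.1, ?_⟩
      rw [h2 _ _ ih.1, ih.2]
      field_simp
      ring
  obtain ⟨ha, hb⟩ := h3 (l - 1)
  rw [h2 _ _ (h1 _ _ ha), h2 _ _ ha, hb]
  field_simp
  ring
end
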